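/- arXiv:1806.04279 — 2 statements merged into one kernel-verified Lean document; each statement's English description precedes it below -/
import Mathlib

section
/- Every finite abelian noncyclic 2-group G admits a (G, 4, 1) difference matrix. -/
def IsAddDiffMatrix {G : Type*} [AddGroup G] {I J : Type*} (A : I → J → G) (lam : ℕ) : Prop :=
  Nat.card J = lam * Nat.card G ∧
  ∀ i ℓ : I, i ≠ ℓ → ∀ g : G, Nat.card {j : J // A i j - A ℓ j = g} = lam

/-- `A` is a matrix with four rows over `G`, with the columns indexed by a type of the size of `G`,
all of whose row differences are injective. -/
def HasFourRows (G : Type*) [AddGroup G] : Prop :=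
  ∃ A : Fin 4 → Fin (Nat.card G) → G, ∀ i l, i ≠ l → Function.Injective fun j => A i j - A l j

namespace HasFourRows

theorem of_card_eq {G J : Type*} [AddGroup G] [Finite G] (hJ : Nat.card J = Nat.card G)
    (A : Fin 4 → J → G) (hA : ∀ i l, i ≠ l → Function.Injective fun j => A i j - A l j) :
    HasFourRows G := by
  have : Finite J := Nat.finite_of_card_ne_zero (hJ ▸ Nat.card_pos.ne')
  let e : Fin (Nat.card G) ≃ J := (finCongr hJ.symm).trans (Finite.equivFin J).symm
  exact ⟨fun i j => A i (e j), fun i l h => (hA i l h).comp e.injective⟩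

theorem exists_isAddDiffMatrix {G : Type*} [AddGroup G] [Finite G] (h : HasFourRows G) :
    ∃ A : Fin 4 → Fin (Nat.card G) → G, IsAddDiffMatrix A 1 := by
  obtain ⟨A, hA⟩ := h
  refine ⟨A, by simp, fun i l hil g => ?_⟩
  have hb := (Nat.bijective_iff_injective_and_card _).2 ⟨hA i l hil, by simp⟩
  obtain ⟨j, hj, hu⟩ := hb.existsUnique g
  rw [Nat.card_eq_one_iff_exists]
  exact ⟨⟨j, hj⟩, fun k => Subtype.ext (hu k.1 k.2)⟩

theorem of_two_maps {G J : Type*} [AddCommGroup G] [Finite G] (hJ : Nat.card J = Nat.card G)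
    (x y : J → G) (hx : Function.Injective x) (hy : Function.Injective y)
    (hadd : Function.Injective fun j => x j + y j)
    (hsub : Function.Injective fun j => x j - y j) : HasFourRows G := by
  let A : Fin 4 → J → G := ![0, x, y, fun j => x j + y j]
  have hlt : ∀ i l, i < l → Function.Injective fun j => A i j - A l j := by
    intro i l hil j k hjk
    replace hjk : A i j - A l j = A i k - A l k := hjk
    fin_cases i <;> fin_cases l <;> first | exact absurd hil (by decide) | skip
    · exact hx (by simpa [A] using hjk)
    · exact hy (by simpa [A] using hjk)
    · exact hadd (sub_right_injective (b := (0 : G)) hjk)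
    · exact hsub hjk
    · exact hy (by simpa [A] using hjk)
    · exact hx (by simpa [A] using hjk)
  refine of_card_eq hJ A fun i l hil => ?_
  rcases hil.lt_or_gt with h | h
  · exact hlt i l h
  · intro j k hjk
    refine hlt l i h (neg_injective ?_)
    simpa only [neg_sub] using hjk

theorem of_extension {H G Q : Type*} [AddCommGroup H] [AddCommGroup G] [AddCommGroup Q] [Finite G]
    (i : H →+ G) (f : G →+ Q) (hi : Function.Injective i) (hf : Function.Surjective f)
    (hfi : ∀ h, f (i h) = 0) (hcard : Nat.card H * Nat.card Q = Nat.card G)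
    (hH : HasFourRows H) (hQ : HasFourRows Q) : HasFourRows G := by
  obtain ⟨A, hA⟩ := hH
  obtain ⟨B, hB⟩ := hQ
  refine of_card_eq (J := Fin (Nat.card H) × Fin (Nat.card Q)) (by simpa using hcard)
    (fun r j => i (A r j.1) + Function.surjInv hf (B r j.2)) ?_
  rintro r l hrl ⟨h, q⟩ ⟨h', q'⟩ e
  have e' : i (A r h) + Function.surjInv hf (B r q) - (i (A l h) + Function.surjInv hf (B l q)) =
    i (A r h') + Function.surjInv hf (B r q') - (i (A l h') + Function.surjInv hf (B l q')) := e
  have hq : q = q' := hB r l hrl (by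
    simpa [hfi, Function.surjInv_eq] using congrArg f e')
  subst hq
  have hh : h = h' := hA r l hrl (hi (by
    rw [map_sub, map_sub]
    rwa [add_sub_add_comm, add_sub_add_comm, add_left_inj] at e'))
  rw [hh]

theorem of_addEquiv {G H : Type*} [AddGroup G] [AddGroup H] [Finite H] (e : G ≃+ H)
    (h : HasFourRows G) : HasFourRows H := by
  obtain ⟨A, hA⟩ := h
  refine of_card_eq (J := Fin (Nat.card G)) (by simpa using Nat.card_congr e.toEquiv)
    (fun i j => e (A i j)) fun i l hil j k hjk => hA i l hil (e.injective ?_)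
  simpa using hjk

theorem prod {G H : Type*} [AddCommGroup G] [AddCommGroup H] [Finite G] [Finite H]
    (hG : HasFourRows G) (hH : HasFourRows H) : HasFourRows (G × H) :=
  of_extension (AddMonoidHom.inl G H) (AddMonoidHom.snd G H)
    (fun _ _ h => (Prod.ext_iff.1 h).1) Prod.snd_surjective (fun _ => rfl)
    (Nat.card_prod G H).symm hG hH

end HasFourRows

/-- The leading binary digit of an element of `ZMod (2 ^ (a + 1))`. -/
def topBit (a : ℕ) (t : ZMod (2 ^ (a + 1))) : ZMod 2 := if t.val < 2 ^ a then 0 else 1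

theorem topBit_add_two_pow (a : ℕ) (t : ZMod (2 ^ (a + 1))) :
    topBit a (t + 2 ^ a) = topBit a t + 1 := by
  have hN : 2 ^ (a + 1) = 2 * 2 ^ a := by ring
  have hpos : 0 < 2 ^ a := by positivity
  have hv : ((2 ^ a : ZMod (2 ^ (a + 1)))).val = 2 ^ a := by
    have := ZMod.val_natCast_of_lt (n := 2 ^ (a + 1)) (a := 2 ^ a) (by omega)
    simpa using this
  have ht := t.val_lt
  unfold topBit
  rw [ZMod.val_add, hv]
  by_cases h : t.val < 2 ^ a
  · rw [Nat.mod_eq_of_lt (by omega), if_neg (by omega), if_pos h, zero_add]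
  · rw [Nat.mod_eq_sub_mod (by omega), Nat.mod_eq_of_lt (by omega), if_pos (by omega), if_neg h]
    rfl

theorem two_pow_add_self_zmod (a : ℕ) : (2 ^ a + 2 ^ a : ZMod (2 ^ (a + 1))) = 0 := by
  have := ZMod.natCast_self (2 ^ (a + 1))
  push_cast at this
  rw [← this]
  ring

theorem eq_or_eq_add_of_two_mul_eq (a : ℕ) (t u : ZMod (2 ^ (a + 1))) (h : 2 * t = 2 * u) :
    t = u ∨ t = u + 2 ^ a := by
  obtain ⟨d, rfl⟩ : ∃ d, t = u + d := ⟨t - u, by ring⟩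
  have hd : 2 * d = 0 := by linear_combination h
  obtain ⟨n, rfl⟩ := ZMod.intCast_surjective d
  have h1 : ((2 * n : ℤ) : ZMod (2 ^ (a + 1))) = 0 := by push_cast; exact hd
  rw [ZMod.intCast_zmod_eq_zero_iff_dvd] at h1
  push_cast at h1
  rw [pow_succ'] at h1
  obtain ⟨k, rfl⟩ := Int.dvd_of_mul_dvd_mul_left (by norm_num) h1
  have h2 := two_pow_add_self_zmod a
  rcases Int.even_or_odd' k with ⟨m, rfl | rfl⟩
  · left
    push_cast
    linear_combination (m : ZMod (2 ^ (a + 1))) * h2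
  · right
    push_cast
    linear_combination (m : ZMod (2 ^ (a + 1))) * h2

theorem isUnit_three_zmod (a : ℕ) : IsUnit (3 : ZMod (2 ^ (a + 1))) := by
  have : Nat.Coprime 3 (2 ^ (a + 1)) := Nat.Coprime.pow_right _ (by norm_num)
  simpa using (ZMod.isUnit_iff_coprime 3 (2 ^ (a + 1))).2 this

theorem eq_zero_or_eq_one_zmod_two (s : ZMod 2) : s = 0 ∨ s = 1 := by
  revert s
  decide

/-- The lift of the residues modulo two to the representatives zero and one. -/
def liftBit (R : Type*) [Zero R] [One R] (s : ZMod 2) : R := if s = 0 then 0 else 1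

theorem hasFourRows_two_pow_prod_two (a : ℕ) : HasFourRows (ZMod (2 ^ (a + 1)) × ZMod 2) := by
  have hA := two_pow_add_self_zmod a
  refine HasFourRows.of_two_maps (J := ZMod (2 ^ (a + 1)) × ZMod 2) rfl
    (fun j => (j.1 + 2 ^ a * liftBit _ j.2, topBit a j.1))
    (fun j => (2 * j.1 + liftBit _ j.2, j.2 + topBit a j.1)) ?_ ?_ ?_ ?_
  · rintro ⟨t, s⟩ ⟨t', s'⟩ h
    simp only [Prod.mk.injEq] at h ⊢
    obtain ⟨h1, h2⟩ := h
    have key := topBit_add_two_pow a t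
    rcases eq_zero_or_eq_one_zmod_two s with rfl | rfl <;>
      rcases eq_zero_or_eq_one_zmod_two s' with rfl | rfl <;> simp [liftBit] at h1 ⊢
    · exact h1
    · have : t + 2 ^ a = t' := by linear_combination h1 + hA
      rw [this, h2] at key
      simp at key
    · rw [h1, h2] at key
      simp at key
    · exact h1
  · rintro ⟨t, s⟩ ⟨t', s'⟩ h
    simp only [Prod.mk.injEq] at h ⊢
    obtain ⟨h1, h2⟩ := h
    have hs : s = s' := by
      have hc (t : ZMod (2 ^ (a + 1))) (s : ZMod 2) :
          ZMod.castHom (dvd_pow_self 2 a.succ_ne_zero) (ZMod 2) (2 * t + liftBit _ s) = s := by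
        rw [map_add, map_mul, map_ofNat, show (OfNat.ofNat 2 : ZMod 2) = 0 from rfl, zero_mul,
          zero_add]
        rcases eq_zero_or_eq_one_zmod_two s with rfl | rfl <;> simp [liftBit]
      rw [← hc t s, h1, hc]
    subst hs
    refine ⟨?_, rfl⟩
    rcases eq_or_eq_add_of_two_mul_eq a t t' (by simpa using h1) with h | h
    · exact h
    · rw [h, topBit_add_two_pow] at h2
      simp at h2
  · rintro ⟨t, s⟩ ⟨t', s'⟩ h
    simp only [Prod.mk.injEq, Prod.mk_add_mk] at h ⊢
    obtain ⟨h1, h2⟩ := h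
    have hz (b s : ZMod 2) : b + (s + b) = s := by revert b s; decide
    rw [hz, hz] at h2
    subst h2
    exact ⟨(isUnit_three_zmod a).mul_left_cancel (by linear_combination h1), rfl⟩
  · rintro ⟨t, s⟩ ⟨t', s'⟩ h
    simp only [Prod.mk.injEq, Prod.mk_sub_mk] at h ⊢
    obtain ⟨h1, h2⟩ := h
    have hz (b s : ZMod 2) : b - (s + b) = s := by revert b s; decide
    rw [hz, hz] at h2
    subst h2
    exact ⟨by linear_combination -h1, rfl⟩

/-- The embedding of the group of order two in a cyclic group of order `2 ^ (a + 1)`. -/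
def zmodTwoHom (a : ℕ) : ZMod 2 →+ ZMod (2 ^ (a + 1)) :=
  ZMod.lift 2 ⟨zmultiplesHom _ (2 ^ a), by
    have := two_pow_add_self_zmod a
    simpa [two_mul] using this⟩

theorem zmodTwoHom_one (a : ℕ) : zmodTwoHom a 1 = 2 ^ a := by
  have := ZMod.lift_coe 2 (A := ZMod (2 ^ (a + 1))) ⟨zmultiplesHom _ (2 ^ a), by
    have := two_pow_add_self_zmod a
    simpa [two_mul] using this⟩ 1
  simpa [zmodTwoHom] using this

theorem zmodTwoHom_injective (a : ℕ) : Function.Injective (zmodTwoHom a) := by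
  rw [injective_iff_map_eq_zero]
  intro s hs
  rcases eq_zero_or_eq_one_zmod_two s with rfl | rfl
  · rfl
  · have key := topBit_add_two_pow a 0
    rw [← zmodTwoHom_one, hs] at key
    simp at key

/-- Reduction modulo `2 ^ a`. -/
def zmodReduce (a : ℕ) : ZMod (2 ^ (a + 1)) →+ ZMod (2 ^ a) :=
  (ZMod.castHom (pow_dvd_pow 2 a.le_succ) (ZMod (2 ^ a)) : ZMod (2 ^ (a + 1)) →+* _)

theorem zmodReduce_surjective (a : ℕ) : Function.Surjective (zmodReduce a) :=
  ZMod.castHom_surjective (pow_dvd_pow 2 a.le_succ)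

theorem zmodReduce_zmodTwoHom (a : ℕ) (s : ZMod 2) : zmodReduce a (zmodTwoHom a s) = 0 := by
  rcases eq_zero_or_eq_one_zmod_two s with rfl | rfl
  · simp
  · rw [zmodTwoHom_one]
    have := ZMod.natCast_self (2 ^ a)
    push_cast at this
    change ZMod.castHom (pow_dvd_pow 2 a.le_succ) (ZMod (2 ^ a)) (2 ^ a) = 0
    rw [map_pow, map_ofNat, this]

theorem hasFourRows_prod_zmod (a b : ℕ) :
    HasFourRows (ZMod (2 ^ (a + 1)) × ZMod (2 ^ (b + 1))) := by
  induction a generalizing b with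
  | zero => exact (hasFourRows_two_pow_prod_two b).of_addEquiv AddEquiv.prodComm
  | succ a ih =>
    cases b with
    | zero => exact hasFourRows_two_pow_prod_two (a + 1)
    | succ b =>
      refine HasFourRows.of_extension
        ((zmodTwoHom (a + 1)).prodMap (zmodTwoHom (b + 1)))
        ((zmodReduce (a + 1)).prodMap (zmodReduce (b + 1)))
        ((zmodTwoHom_injective _).prodMap (zmodTwoHom_injective _))
        ((zmodReduce_surjective _).prodMap (zmodReduce_surjective _)) ?_ ?_
        (hasFourRows_two_pow_prod_two 0) (ih b)
      · rintro ⟨s, t⟩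
        exact Prod.ext (zmodReduce_zmodTwoHom _ s) (zmodReduce_zmodTwoHom _ t)
      · simp only [Nat.card_prod, Nat.card_zmod]
        ring

theorem hasFourRows_zmod_two_cubed : HasFourRows (ZMod 2 × ZMod 2 × ZMod 2) := by
  refine HasFourRows.of_two_maps (J := ZMod 2 × ZMod 2 × ZMod 2) rfl id
    (fun v => (v.2.2, v.1 + v.2.2, v.2.1)) ?_ ?_ ?_ ?_ <;> decide

theorem hasFourRows_prod_prod_zmod_of_succ (a b c : ℕ) :
    HasFourRows (ZMod (2 ^ (a + 2)) × ZMod (2 ^ (b + 1)) × ZMod (2 ^ (c + 1))) := by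
  refine HasFourRows.of_extension
    ((zmodTwoHom (a + 1)).prodMap (AddMonoidHom.inr _ _))
    ((zmodReduce (a + 1)).prodMap (AddMonoidHom.fst _ _))
    ((zmodTwoHom_injective _).prodMap fun _ _ h => (Prod.ext_iff.1 h).2)
    ((zmodReduce_surjective _).prodMap Prod.fst_surjective) ?_ ?_
    (hasFourRows_prod_zmod 0 c) (hasFourRows_prod_zmod a b)
  · rintro ⟨s, t⟩
    exact Prod.ext (zmodReduce_zmodTwoHom _ s) rfl
  · simp only [Nat.card_prod, Nat.card_zmod]
    ring

theorem hasFourRows_prod_prod_zmod (a b c : ℕ) :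
    HasFourRows (ZMod (2 ^ (a + 1)) × ZMod (2 ^ (b + 1)) × ZMod (2 ^ (c + 1))) := by
  rcases a with - | a
  · rcases b with - | b
    · rcases c with - | c
      · exact hasFourRows_zmod_two_cubed
      · exact (hasFourRows_prod_prod_zmod_of_succ c 0 0).of_addEquiv
          (AddEquiv.prodComm.trans AddEquiv.prodAssoc)
    · exact (hasFourRows_prod_prod_zmod_of_succ b c 0).of_addEquiv
        (AddEquiv.prodAssoc.symm.trans AddEquiv.prodComm)
  · exact hasFourRows_prod_prod_zmod_of_succ a b c

/-- Splitting off the first factor of a finite product of additive groups. -/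
def addEquivPiFinSucc {n : ℕ} (M : Fin (n + 1) → Type*) [∀ i, AddCommGroup (M i)] :
    (M 0 × ∀ i : Fin n, M i.succ) ≃+ ∀ i, M i :=
  { Fin.consEquiv M with
    map_add' := fun x y => by
      ext i
      refine Fin.cases ?_ (fun i => ?_) i <;> simp [Fin.consEquiv] }

theorem hasFourRows_pi_zmod (n : ℕ) (e : Fin (n + 2) → ℕ) :
    HasFourRows (∀ i, ZMod (2 ^ (e i + 1))) := by
  induction n using Nat.twoStepInduction with
  | zero =>
    refine (hasFourRows_prod_zmod (e 0) (e 1)).of_addEquiv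
      (.trans (.prodCongr (.refl _) ?_) (addEquivPiFinSucc fun i => ZMod (2 ^ (e i + 1))))
    exact (AddEquiv.piUnique fun i : Fin 1 => ZMod (2 ^ (e i.succ + 1))).symm
  | one =>
    refine (hasFourRows_prod_prod_zmod (e 0) (e 1) (e 2)).of_addEquiv
      (.trans (.prodCongr (.refl _) (.trans (.prodCongr (.refl _) ?_)
        (addEquivPiFinSucc fun i : Fin 2 => ZMod (2 ^ (e i.succ + 1)))))
        (addEquivPiFinSucc fun i => ZMod (2 ^ (e i + 1))))
    exact (AddEquiv.piUnique fun i : Fin 1 => ZMod (2 ^ (e i.succ.succ + 1))).symm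
  | more n ih _ =>
    exact ((hasFourRows_prod_zmod (e 0) (e 1)).prod (ih fun i => e i.succ.succ)).of_addEquiv
      (.trans AddEquiv.prodAssoc (.trans (.prodCongr (.refl _)
        (addEquivPiFinSucc fun i : Fin (n + 3) => ZMod (2 ^ (e i.succ + 1))))
        (addEquivPiFinSucc fun i => ZMod (2 ^ (e i + 1)))))

theorem exists_addEquiv_pi_zmod_two_pow (G : Type*) [AddCommGroup G] [Finite G]
    (h2 : ∃ k : ℕ, Nat.card G = 2 ^ k) :
    ∃ (n : ℕ) (e : Fin n → ℕ), Nonempty ((∀ i, ZMod (2 ^ (e i + 1))) ≃+ G) := by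
  obtain ⟨k, hk⟩ := h2
  obtain ⟨ι, _, m, hm, ⟨φ⟩⟩ := AddCommGroup.equiv_directSum_zmod_of_finite' G
  classical
  let ψ : G ≃+ ∀ i, ZMod (m i) := φ.trans (DirectSum.addEquivProd _)
  have hcard : ∏ i, m i = 2 ^ k := by
    rw [← hk, Nat.card_congr ψ.toEquiv, Nat.card_pi]
    simp
  have hpow : ∀ i, ∃ e, m i = 2 ^ (e + 1) := fun i => by
    obtain ⟨e, -, he⟩ := (Nat.dvd_prime_pow Nat.prime_two).1
      (hcard ▸ Finset.dvd_prod_of_mem m (Finset.mem_univ i))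
    have := hm i
    rcases e with - | e
    · simp [he] at this
    · exact ⟨e, he⟩
  choose e he using hpow
  obtain rfl : m = fun i => 2 ^ (e i + 1) := funext he
  let s := (Fintype.equivFin ι).symm
  refine ⟨Fintype.card ι, fun i => e (s i), ⟨.trans ?_ ψ.symm⟩⟩
  exact { Equiv.piCongrLeft (fun i => ZMod (2 ^ (e i + 1))) s with
    map_add' := fun x y => by
      ext i
      obtain ⟨j, rfl⟩ := s.surjective i
      simp [Equiv.piCongrLeft_apply_apply] }

/-- Every finite abelian noncyclic 2-group admits a `(G, 4, 1)` difference matrix. -/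
theorem stmt_9 (G : Type*) [AddCommGroup G] [Finite G]
    (h2 : ∃ k : ℕ, Nat.card G = 2 ^ k) (hnc : ¬ IsAddCyclic G) :
    ∃ A : Fin 4 → Fin (Nat.card G) → G, IsAddDiffMatrix A 1 := by
  obtain ⟨n, e, ⟨φ⟩⟩ := exists_addEquiv_pi_zmod_two_pow G h2
  rcases n with - | - | n
  · have : Subsingleton G := φ.symm.injective.subsingleton
    exact absurd isAddCyclic_of_subsingleton hnc
  · have ψ : ZMod (2 ^ (e 0 + 1)) ≃+ G :=
      (AddEquiv.piUnique fun i : Fin 1 => ZMod (2 ^ (e i + 1))).symm.trans φ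
    exact absurd (isAddCyclic_of_surjective ψ ψ.surjective) hnc
  · exact ((hasFourRows_pi_zmod n e).of_addEquiv φ).exists_isAddDiffMatrix
end

section
/- Every finite abelian noncyclic 2-group G admits a (G, 2, 0) contracted difference matrix. -/
/-- The `p`-expansion of a `k × l` matrix over an abelian group: the `p^k × p^l` matrix
whose `(r, c)` entry is `r M cᵀ`. -/
def pExpand (p : ℕ) {G : Type*} [AddCommGroup G] {k l : ℕ} (M : Fin k → Fin l → G) :
    (Fin k → ZMod p) → (Fin l → ZMod p) → G :=
  fun r c => ∑ i, ∑ j, ((r i).val * (c j).val) • M i j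

/-- A `k × l` matrix `M` over an abelian `p`-group `G` (of order `p^n`, with `l = n + s`)
is a `(G, k, s)` contracted difference matrix if its `p`-expansion is a `(G, p^k, p^s)`
difference matrix. -/
def IsCDM (p : ℕ) {G : Type*} [AddCommGroup G] {k l : ℕ} (M : Fin k → Fin l → G)
    (s : ℕ) : Prop :=
  IsAddDiffMatrix (pExpand p M) (p ^ s)

/-- The integer combination `∑ i j, a i * b j • M i j`, that is `a M bᵀ`. -/
def signedForm {G κ ι : Type*} [AddCommGroup G] [Fintype κ] [Fintype ι]
    (M : κ → ι → G) (a : κ → ℤ) (b : ι → ℤ) : G :=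
  ∑ i, ∑ j, (a i * b j) • M i j

/-- `a M bᵀ` vanishes, for `a` and `b` with entries in `{-1, 0, 1}`, only if `a = 0` or `b = 0`. -/
def SignedNondegenerate {G κ ι : Type*} [AddCommGroup G] [Fintype κ] [Fintype ι]
    (M : κ → ι → G) : Prop :=
  ∀ a b, (∀ i, |a i| ≤ 1) → (∀ j, |b j| ≤ 1) → signedForm M a b = 0 → a = 0 ∨ b = 0

/-- A sequence none of whose nontrivial combinations with coefficients in `{-1, 0, 1}` vanishes. -/
def SignedIndependent {G ι : Type*} [AddCommGroup G] [Fintype ι] (x : ι → G) : Prop :=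
  ∀ b : ι → ℤ, (∀ j, |b j| ≤ 1) → ∑ j, b j • x j = 0 → b = 0

/-- `G` carries a nondegenerate two-rowed matrix with `log₂ |G|` columns. -/
def HasTwoRowCDM (G : Type*) [AddCommGroup G] : Prop :=
  ∃ (ι : Type) (_ : Fintype ι) (M : Fin 2 → ι → G),
    Nat.card G = 2 ^ Fintype.card ι ∧ SignedNondegenerate M

theorem map_signedForm {G H κ ι : Type*} [AddCommGroup G] [AddCommGroup H] [Fintype κ]
    [Fintype ι] (f : G →+ H) (M : κ → ι → G) (a : κ → ℤ) (b : ι → ℤ) :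
    f (signedForm M a b) = signedForm (fun i j => f (M i j)) a b := by
  simp [signedForm, map_sum]

theorem signedNondegenerate_of_signedIndependent {G ι : Type*} [AddCommGroup G] [Fintype ι]
    (x y : ι → G) (hx : SignedIndependent x) (hy : SignedIndependent y)
    (hadd : SignedIndependent (x + y)) (hsub : SignedIndependent (x - y)) :
    SignedNondegenerate ![x, y] := by
  intro a b ha hb h
  have key : ∑ j, b j • (a 0 • x j + a 1 • y j) = 0 := by
    rw [← h, signedForm, Fin.sum_univ_two, ← Finset.sum_add_distrib]
    refine Finset.sum_congr rfl fun j _ => ?_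
    simp [smul_smul, mul_comm]
  have h0 := abs_le.1 (ha 0)
  have h1 := abs_le.1 (ha 1)
  have e0 : a 0 = -1 ∨ a 0 = 0 ∨ a 0 = 1 := by omega
  have e1 : a 1 = -1 ∨ a 1 = 0 ∨ a 1 = 1 := by omega
  have of_neg {z : ι → G} (hz : SignedIndependent z) (h' : ∑ j, b j • -z j = 0) : b = 0 :=
    hz b hb (by simpa using h')
  rcases e0 with e0 | e0 | e0 <;> rcases e1 with e1 | e1 | e1 <;>
    simp only [e0, e1, neg_smul, one_smul, zero_smul, zero_add, add_zero] at key
  · exact .inr (of_neg hadd (by simpa only [Pi.add_apply, neg_add] using key))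
  · exact .inr (of_neg hx key)
  · exact .inr (of_neg hsub (by simpa only [Pi.sub_apply, neg_sub, neg_add_eq_sub] using key))
  · exact .inr (of_neg hy key)
  · left
    ext i
    fin_cases i
    · exact e0
    · exact e1
  · exact .inr (hy b hb key)
  · exact .inr (hsub b hb (by simpa only [Pi.sub_apply, sub_eq_add_neg] using key))
  · exact .inr (hx b hb key)
  · exact .inr (hadd b hb key)

/-- `H`, `G`, `Q` are the terms of a short exact sequence of finite abelian groups. -/
def ShortExactTerms (H G Q : Type*) [AddCommGroup H] [AddCommGroup G] [AddCommGroup Q] : Prop :=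
  ∃ (i : H →+ G) (f : G →+ Q), Function.Injective i ∧ Function.Surjective f ∧
    (∀ h, f (i h) = 0) ∧ Nat.card G = Nat.card H * Nat.card Q

theorem HasTwoRowCDM.of_shortExactTerms {H G Q : Type*} [AddCommGroup H] [AddCommGroup G]
    [AddCommGroup Q] (hs : ShortExactTerms H G Q) (hH : HasTwoRowCDM H) (hQ : HasTwoRowCDM Q) :
    HasTwoRowCDM G := by
  obtain ⟨i, f, hi, hf, hfi, hcard⟩ := hs
  obtain ⟨ι, _, M, hM, hMn⟩ := hH
  obtain ⟨κ, _, N, hN, hNn⟩ := hQ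
  choose g hg using hf
  refine ⟨ι ⊕ κ, inferInstance, fun r => Sum.elim (fun c => i (M r c)) (fun c => g (N r c)),
    ?_, ?_⟩
  · rw [hcard, hM, hN, Fintype.card_sum, pow_add]
  intro a b ha hb h
  have split : signedForm (fun r c => i (M r c)) a (b ∘ Sum.inl) +
      signedForm (fun r c => g (N r c)) a (b ∘ Sum.inr) = 0 := by
    rw [← h]
    simp only [signedForm, Fintype.sum_sum_type, Finset.sum_add_distrib, Sum.elim_inl,
      Sum.elim_inr, Function.comp_apply]
  have hq : signedForm N a (b ∘ Sum.inr) = 0 := by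
    have := congrArg f split
    rw [map_add, map_signedForm, map_signedForm] at this
    simpa [hfi, hg, signedForm] using this
  obtain ha0 | hb2 := hNn _ _ ha (fun j => hb _) hq
  · exact .inl ha0
  have hh : signedForm M a (b ∘ Sum.inl) = 0 := by
    apply hi
    rw [map_signedForm, map_zero, ← split, show b ∘ Sum.inr = 0 from hb2]
    simp [signedForm]
  obtain ha0 | hb1 := hMn _ _ ha (fun j => hb _) hh
  · exact .inl ha0
  right
  ext (j | j)
  · exact congrFun hb1 j
  · exact congrFun hb2 j

theorem HasTwoRowCDM.congr {G H : Type*} [AddCommGroup G] [AddCommGroup H] (e : G ≃+ H)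
    (h : HasTwoRowCDM G) : HasTwoRowCDM H := by
  obtain ⟨ι, _, M, hM, hMn⟩ := h
  refine ⟨ι, inferInstance, fun r c => e (M r c), by rw [← Nat.card_congr e.toEquiv, hM], ?_⟩
  intro a b ha hb h0
  refine hMn a b ha hb (e.injective ?_)
  rw [map_zero, ← h0]
  exact map_signedForm e.toAddMonoidHom M a b

theorem ShortExactTerms.prod {A B C A' B' C' : Type*} [AddCommGroup A] [AddCommGroup B]
    [AddCommGroup C] [AddCommGroup A'] [AddCommGroup B'] [AddCommGroup C']
    (h : ShortExactTerms A B C) (h' : ShortExactTerms A' B' C') :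
    ShortExactTerms (A × A') (B × B') (C × C') := by
  obtain ⟨i, f, hi, hf, hfi, hc⟩ := h
  obtain ⟨i', f', hi', hf', hfi', hc'⟩ := h'
  refine ⟨i.prodMap i', f.prodMap f', hi.prodMap hi', hf.prodMap hf', ?_, ?_⟩
  · rintro ⟨x, y⟩
    simp [hfi, hfi']
  · rw [Nat.card_prod, Nat.card_prod, Nat.card_prod, hc, hc']
    ring

theorem ShortExactTerms.left (A : Type*) [AddCommGroup A] : ShortExactTerms A A PUnit.{1} :=
  ⟨.id A, 0, fun _ _ h => h, fun _ => ⟨0, rfl⟩, fun _ => rfl, by simp⟩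

theorem ShortExactTerms.right (A : Type*) [AddCommGroup A] : ShortExactTerms PUnit.{1} A A :=
  ⟨0, .id A, fun _ _ _ => rfl, fun x => ⟨x, rfl⟩, fun _ => rfl, by simp⟩

theorem HasTwoRowCDM.prod {A B : Type*} [AddCommGroup A] [AddCommGroup B]
    (hA : HasTwoRowCDM A) (hB : HasTwoRowCDM B) : HasTwoRowCDM (A × B) :=
  .of_shortExactTerms ((ShortExactTerms.left A).prod (.right B))
    (hA.congr (AddEquiv.prodUnique (N := PUnit)).symm)
    (hB.congr (AddEquiv.uniqueProd (N := PUnit)).symm)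

theorem shortExactTerms_zmod_two_pow (a : ℕ) :
    ShortExactTerms (ZMod (2 ^ 1)) (ZMod (2 ^ (a + 1))) (ZMod (2 ^ a)) := by
  have hz : (zmultiplesHom (ZMod (2 ^ (a + 1))) (2 ^ a)) ((2 ^ 1 : ℕ) : ℤ) = 0 := by
    have : ((2 ^ (a + 1) : ℕ) : ZMod (2 ^ (a + 1))) = 0 := ZMod.natCast_self _
    push_cast at this
    simp only [zmultiplesHom_apply, natCast_zsmul, nsmul_eq_mul]
    push_cast
    rw [← this]
    ring
  refine ⟨ZMod.lift _ ⟨_, hz⟩,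
    (ZMod.castHom (pow_dvd_pow 2 (Nat.le_succ a)) (ZMod (2 ^ a)) :
      ZMod (2 ^ (a + 1)) →+* ZMod (2 ^ a)).toAddMonoidHom, ?_,
    ZMod.castHom_surjective (pow_dvd_pow 2 (Nat.le_succ a)), ?_, ?_⟩
  · rw [ZMod.lift_injective]
    intro m hm
    have : ((m * 2 ^ a : ℤ) : ZMod (2 ^ (a + 1))) = 0 := by
      simpa [zmultiplesHom_apply] using hm
    rw [ZMod.intCast_zmod_eq_zero_iff_dvd] at this
    rw [ZMod.intCast_zmod_eq_zero_iff_dvd]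
    push_cast at this ⊢
    rw [pow_succ'] at this
    simpa using Int.dvd_of_mul_dvd_mul_right (by positivity) this
  · intro h
    obtain ⟨m, rfl⟩ := ZMod.intCast_surjective h
    have : ((2 ^ a : ℕ) : ZMod (2 ^ a)) = 0 := ZMod.natCast_self _
    push_cast at this
    change ZMod.castHom (pow_dvd_pow 2 (Nat.le_succ a)) (ZMod (2 ^ a)) (ZMod.lift _ ⟨_, hz⟩ m) = 0
    rw [ZMod.lift_coe, zmultiplesHom_apply, zsmul_eq_mul, map_mul, map_pow, map_ofNat, this,
      mul_zero]
  · simp [pow_succ']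

theorem eq_zero_of_two_pow_dvd_sum (n : ℕ) (u c : ℕ → ℤ) (hu : ∀ i, Odd (u i))
    (hc : ∀ i < n, |c i| ≤ 1) (h : (2 : ℤ) ^ n ∣ ∑ i ∈ Finset.range n, c i * (u i * 2 ^ i)) :
    ∀ i < n, c i = 0 := by
  induction n generalizing u c with
  | zero => simp
  | succ n ih =>
    have hsum : ∑ i ∈ Finset.range (n + 1), c i * (u i * 2 ^ i) =
        2 * ∑ i ∈ Finset.range n, c (i + 1) * (u (i + 1) * 2 ^ i) + c 0 * u 0 := by
      rw [Finset.sum_range_succ', Finset.mul_sum]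
      congr 1
      · exact Finset.sum_congr rfl fun i _ => by ring
      · ring
    rw [hsum, pow_succ'] at h
    have h0 : c 0 = 0 := by
      have h2 : (2 : ℤ) ∣ c 0 * u 0 :=
        (Int.dvd_add_right (dvd_mul_right _ _)).1 ((dvd_mul_right _ _).trans h)
      have h3 : (2 : ℤ) ∣ c 0 := (Int.prime_two.dvd_mul.1 h2).resolve_right fun h' =>
        Int.not_even_iff_odd.2 (hu 0) (even_iff_two_dvd.2 h')
      have := abs_le.1 (hc 0 n.succ_pos)
      omega
    rw [h0, zero_mul, add_zero] at h
    have hs := ih (fun i => u (i + 1)) (fun i => c (i + 1)) (fun i => hu _)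
      (fun i hi => hc _ (by omega)) (Int.dvd_of_mul_dvd_mul_left (by norm_num) h)
    rintro (_ | i) hi
    · exact h0
    · exact hs i (by omega)

theorem eq_zero_of_abs_le_one_of_two_dvd {c : ℤ} (hc : |c| ≤ 1) (h : (2 : ℤ) ∣ c) : c = 0 := by
  have := abs_le.1 hc
  omega

/-- The matrix has columns `(2 ^ i, t i), (2 ^ (i + 1), t i)` for `i ≤ n`, where `t` is the
indicator of `i = n`, and the further column `(0, 1), (1, 0)`. -/
theorem hasTwoRowCDM_zmod_two_pow_prod_zmod_two (n : ℕ) :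
    HasTwoRowCDM (ZMod (2 ^ (n + 1)) × ZMod (2 ^ 1)) := by
  have main (s t : Fin (n + 1) → ℤ) (s₀ t₀ : ℤ)
      (z : Fin (n + 1) ⊕ Unit → ZMod (2 ^ (n + 1)) × ZMod (2 ^ 1))
      (hz : z = Sum.elim (fun i => (Int.cast (s i), Int.cast (t i)))
        (fun _ => (Int.cast s₀, Int.cast t₀)))
      (h : ∀ (c : Fin (n + 1) → ℤ) (d : ℤ), (∀ i, |c i| ≤ 1) → |d| ≤ 1 →
        (2 : ℤ) ^ (n + 1) ∣ ∑ i, c i * s i + d * s₀ → (2 : ℤ) ∣ ∑ i, c i * t i + d * t₀ →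
        (∀ i, c i = 0) ∧ d = 0) : SignedIndependent z := by
    intro b hb h0
    have h1 := congrArg Prod.fst h0
    have h2 := congrArg Prod.snd h0
    simp only [hz, Fintype.sum_sum_type, Prod.fst_add, Prod.snd_add, Prod.fst_sum, Prod.snd_sum,
      Sum.elim_inl, Sum.elim_inr, Finset.univ_unique, Finset.sum_singleton, Prod.fst_zero,
      Prod.snd_zero, zsmul_eq_mul] at h1 h2
    have h1' := (ZMod.intCast_zmod_eq_zero_iff_dvd
      (∑ i, b (.inl i) * s i + b (.inr ()) * s₀) (2 ^ (n + 1))).1 (by push_cast; exact h1)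
    have h2' := (ZMod.intCast_zmod_eq_zero_iff_dvd
      (∑ i, b (.inl i) * t i + b (.inr ()) * t₀) (2 ^ 1)).1 (by push_cast; exact h2)
    push_cast at h1' h2'
    obtain ⟨hc, hd⟩ := h _ _ (fun i => hb _) (hb _) h1' h2'
    ext (i | ⟨⟩)
    · exact hc i
    · exact hd
  let t : Fin (n + 1) → ℤ := Pi.single (Fin.last n) 1
  have sum_t (c : Fin (n + 1) → ℤ) : ∑ i, c i * t i = c (Fin.last n) := by
    simp [t, Pi.single_apply]
  have odd_mul (k : ℤ) (hk : Odd k) (c : Fin (n + 1) → ℤ) (hc : ∀ i, |c i| ≤ 1)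
      (h : (2 : ℤ) ^ (n + 1) ∣ ∑ i, c i * (k * 2 ^ (i : ℕ))) (i : Fin (n + 1)) : c i = 0 := by
    have := eq_zero_of_two_pow_dvd_sum (n + 1) (fun _ => k)
      (fun i => if hi : i < n + 1 then c ⟨i, hi⟩ else 0) (fun _ => hk)
      (fun i hi => by simpa [hi] using hc _)
      (by simpa only [Finset.sum_range, Fin.is_lt, dite_true, Fin.eta] using h) i i.2
    simpa only [Fin.is_lt, dite_true, Fin.eta] using this
  refine ⟨Fin (n + 1) ⊕ Unit, inferInstance, _, ?_, signedNondegenerate_of_signedIndependent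
    (Sum.elim
      (fun i : Fin (n + 1) =>
        (((2 ^ (i : ℕ) : ℤ) : ZMod (2 ^ (n + 1))), ((t i : ℤ) : ZMod (2 ^ 1))))
      (fun _ => (((0 : ℤ) : ZMod (2 ^ (n + 1))), ((1 : ℤ) : ZMod (2 ^ 1)))))
    (Sum.elim
      (fun i : Fin (n + 1) =>
        (((2 ^ ((i : ℕ) + 1) : ℤ) : ZMod (2 ^ (n + 1))), ((t i : ℤ) : ZMod (2 ^ 1))))
      (fun _ => (((1 : ℤ) : ZMod (2 ^ (n + 1))), ((0 : ℤ) : ZMod (2 ^ 1))))) ?_ ?_ ?_ ?_⟩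
  · simp [pow_succ]
  · refine main (fun i => 2 ^ (i : ℕ)) t 0 1 _ rfl fun c d hc hd h1 h2 => ?_
    have hc0 := odd_mul 1 odd_one c hc (by simpa using h1)
    refine ⟨hc0, eq_zero_of_abs_le_one_of_two_dvd hd ?_⟩
    simpa [hc0] using h2
  · refine main (fun i => 2 ^ ((i : ℕ) + 1)) t 1 0 _ rfl fun c d hc hd h1 h2 => ?_
    rw [sum_t, mul_zero, add_zero] at h2
    have hl := eq_zero_of_abs_le_one_of_two_dvd (hc _) h2
    have := odd_mul 1 odd_one (Fin.cons d fun i => c i.castSucc)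
      (fun i => by cases i using Fin.cases <;> simp [hd, hc])
      (by
        rw [Fin.sum_univ_succ]
        rw [Fin.sum_univ_castSucc] at h1
        simpa [hl, add_comm] using h1)
    refine ⟨fun i => ?_, by simpa using this 0⟩
    cases i using Fin.lastCases with
    | last => exact hl
    | cast i => simpa using this i.succ
  · refine main (fun i => 3 * 2 ^ (i : ℕ)) (fun i => 2 * t i) 1 1 _ ?_ fun c d hc hd h1 h2 => ?_
    · ext (i | i) <;> simp <;> ring
    · have hd0 : d = 0 := by
        refine eq_zero_of_abs_le_one_of_two_dvd hd ?_
        rw [mul_one] at h2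
        refine (Int.dvd_add_right (Finset.dvd_sum fun i _ => ?_)).1 h2
        exact ⟨c i * t i, by ring⟩
      exact ⟨odd_mul 3 (by decide) c hc (by simpa [hd0] using h1), hd0⟩
  · refine main (fun i => -1 * 2 ^ (i : ℕ)) 0 (-1) 1 _ ?_ fun c d hc hd h1 h2 => ?_
    · ext (i | i) <;> simp <;> ring
    · have hd0 : d = 0 := eq_zero_of_abs_le_one_of_two_dvd hd (by simpa using h2)
      exact ⟨odd_mul (-1) (by decide) c hc (by simpa [hd0] using h1), hd0⟩

theorem hasTwoRowCDM_zmod_two_pow_prod (a b : ℕ) :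
    HasTwoRowCDM (ZMod (2 ^ (a + 1)) × ZMod (2 ^ (b + 1))) := by
  induction b generalizing a with
  | zero => exact hasTwoRowCDM_zmod_two_pow_prod_zmod_two a
  | succ b ih =>
    cases a with
    | zero => exact (hasTwoRowCDM_zmod_two_pow_prod_zmod_two (b + 1)).congr .prodComm
    | succ a =>
      exact .of_shortExactTerms
        ((shortExactTerms_zmod_two_pow (a + 1)).prod (shortExactTerms_zmod_two_pow (b + 1)))
        (hasTwoRowCDM_zmod_two_pow_prod_zmod_two 0) (ih a)

/-- The second row is the first one multiplied by a generator of the field with eight elements. -/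
theorem hasTwoRowCDM_zmod_two_cube :
    HasTwoRowCDM ((ZMod (2 ^ 1) × ZMod (2 ^ 1)) × ZMod (2 ^ 1)) := by
  have main (s : Fin 3 → (ℤ × ℤ) × ℤ)
      (z : Fin 3 → (ZMod (2 ^ 1) × ZMod (2 ^ 1)) × ZMod (2 ^ 1))
      (hz : ∀ i, z i = ((Int.cast (s i).1.1, Int.cast (s i).1.2), Int.cast (s i).2))
      (h : ∀ c₀ c₁ c₂ : ℤ, (2 : ℤ) ∣ c₀ * (s 0).1.1 + c₁ * (s 1).1.1 + c₂ * (s 2).1.1 →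
        (2 : ℤ) ∣ c₀ * (s 0).1.2 + c₁ * (s 1).1.2 + c₂ * (s 2).1.2 →
        (2 : ℤ) ∣ c₀ * (s 0).2 + c₁ * (s 1).2 + c₂ * (s 2).2 →
        (2 : ℤ) ∣ c₀ ∧ (2 : ℤ) ∣ c₁ ∧ (2 : ℤ) ∣ c₂) : SignedIndependent z := by
    intro b hb h0
    rw [Fin.sum_univ_three] at h0
    simp only [hz, Prod.ext_iff, Prod.fst_add, Prod.snd_add, Prod.smul_mk, zsmul_eq_mul,
      Prod.fst_zero, Prod.snd_zero, ← Int.cast_mul, ← Int.cast_add,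
      ZMod.intCast_zmod_eq_zero_iff_dvd] at h0
    obtain ⟨⟨h1, h2⟩, h3⟩ := h0
    obtain ⟨e0, e1, e2⟩ := h _ _ _ h1 h2 h3
    ext i
    fin_cases i
    · exact eq_zero_of_abs_le_one_of_two_dvd (hb _) e0
    · exact eq_zero_of_abs_le_one_of_two_dvd (hb _) e1
    · exact eq_zero_of_abs_le_one_of_two_dvd (hb _) e2
  refine ⟨Fin 3, inferInstance, _, ?_, signedNondegenerate_of_signedIndependent
    ![((1, 0), 0), ((0, 1), 0), ((0, 0), 1)] ![((0, 1), 0), ((0, 0), 1), ((1, 1), 0)] ?_ ?_ ?_ ?_⟩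
  · simp
  · refine main ![((1, 0), 0), ((0, 1), 0), ((0, 0), 1)] _ (by decide) fun c₀ c₁ c₂ => ?_
    simp
    omega
  · refine main ![((0, 1), 0), ((0, 0), 1), ((1, 1), 0)] _ (by decide) fun c₀ c₁ c₂ => ?_
    simp
    omega
  · refine main ![((1, 1), 0), ((0, 1), 1), ((1, 1), 1)] _ (by decide) fun c₀ c₁ c₂ => ?_
    simp
    omega
  · refine main ![((1, 1), 0), ((0, 1), 1), ((1, 1), 1)] _ (by decide) fun c₀ c₁ c₂ => ?_
    simp
    omega

theorem hasTwoRowCDM_zmod_two_pow_triple (a b c : ℕ) :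
    HasTwoRowCDM ((ZMod (2 ^ (a + 1)) × ZMod (2 ^ (b + 1))) × ZMod (2 ^ (c + 1))) := by
  have main (a b c : ℕ) :
      HasTwoRowCDM ((ZMod (2 ^ (a + 1 + 1)) × ZMod (2 ^ (b + 1))) × ZMod (2 ^ (c + 1))) :=
    .of_shortExactTerms
      (((shortExactTerms_zmod_two_pow (a + 1)).prod (.left (ZMod (2 ^ (b + 1))))).prod (.right _))
      ((hasTwoRowCDM_zmod_two_pow_prod 0 b).congr (AddEquiv.prodUnique (N := PUnit)).symm)
      ((hasTwoRowCDM_zmod_two_pow_prod a c).congr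
        ((AddEquiv.prodUnique (N := PUnit)).symm.prodCongr (.refl _)))
  cases a with
  | succ a => exact main a b c
  | zero =>
    cases b with
    | succ b => exact (main b 0 c).congr (AddEquiv.prodComm.prodCongr (.refl _))
    | zero =>
      cases c with
      | succ c => exact (main c 0 0).congr (AddEquiv.prodAssoc.trans .prodComm)
      | zero => exact hasTwoRowCDM_zmod_two_cube

/-- Splitting off the first factor of a finite product. -/
def piFinSuccAddEquiv {n : ℕ} (A : Fin (n + 1) → Type*) [∀ i, AddCommGroup (A i)] :
    (∀ i, A i) ≃+ A 0 × ∀ i : Fin n, A i.succ :=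
  { (Fin.consEquiv A).symm with map_add' := fun _ _ => rfl }

theorem hasTwoRowCDM_pi_zmod_two_pow (r : ℕ) (e : Fin (r + 2) → ℕ) :
    HasTwoRowCDM (∀ i, ZMod (2 ^ (e i + 1))) := by
  induction r using Nat.twoStepInduction with
  | zero =>
    refine (hasTwoRowCDM_zmod_two_pow_prod (e 0) (e 1)).congr (AddEquiv.symm ?_)
    exact (piFinSuccAddEquiv _).trans (.prodCongr (.refl _)
      ((piFinSuccAddEquiv _).trans .prodUnique))
  | one =>
    refine (hasTwoRowCDM_zmod_two_pow_triple (e 0) (e 1) (e 2)).congr (AddEquiv.symm ?_)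
    exact (piFinSuccAddEquiv _).trans ((AddEquiv.prodCongr (.refl _)
      ((piFinSuccAddEquiv _).trans (.prodCongr (.refl _)
        ((piFinSuccAddEquiv _).trans .prodUnique)))).trans AddEquiv.prodAssoc.symm)
  | more r ih _ =>
    refine ((hasTwoRowCDM_zmod_two_pow_prod (e 0) (e 1)).prod
      (ih fun i => e i.succ.succ)).congr (AddEquiv.symm ?_)
    exact (piFinSuccAddEquiv _).trans ((AddEquiv.prodCongr (.refl _)
      (piFinSuccAddEquiv _)).trans AddEquiv.prodAssoc.symm)

theorem hasTwoRowCDM_of_not_isAddCyclic (G : Type*) [AddCommGroup G] [Finite G]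
    (h2 : ∃ n : ℕ, Nat.card G = 2 ^ n) (hnc : ¬ IsAddCyclic G) : HasTwoRowCDM G := by
  obtain ⟨n, hn⟩ := h2
  obtain ⟨ι, _, m, hm, ⟨E⟩⟩ := AddCommGroup.equiv_directSum_zmod_of_finite' G
  classical
  let E' : G ≃+ ∀ i, ZMod (m i) := E.trans (DirectSum.addEquivProd _)
  have hm2 (i : ι) : ∃ k, m i = 2 ^ (k + 1) := by
    have hd : m i ∣ 2 ^ n := by
      rw [← hn, Nat.card_congr E'.toEquiv, Nat.card_pi]
      simpa using Finset.dvd_prod_of_mem m (Finset.mem_univ i)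
    obtain ⟨k, -, hk⟩ := (Nat.dvd_prime_pow Nat.prime_two).1 hd
    cases k with
    | zero => exact absurd (hm i) (by simp [hk])
    | succ k => exact ⟨k, hk⟩
  choose k hk using hm2
  obtain rfl : m = fun i => 2 ^ (k i + 1) := funext hk
  obtain ⟨r, ⟨σ⟩⟩ : ∃ r, Nonempty (Fin r ≃ ι) := ⟨_, ⟨(Fintype.equivFin ι).symm⟩⟩
  let F : G ≃+ ∀ j : Fin r, ZMod (2 ^ (k (σ j) + 1)) :=
    E'.trans (RingEquiv.piCongrLeft (fun i => ZMod (2 ^ (k i + 1))) σ).symm.toAddEquiv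
  match r, σ, F with
  | 0, _, F =>
    have := F.toEquiv.subsingleton
    exact absurd (inferInstance : IsAddCyclic G) hnc
  | 1, _, F =>
    let F' := F.trans ((piFinSuccAddEquiv _).trans .prodUnique)
    exact absurd (isAddCyclic_of_surjective F'.symm F'.symm.surjective) hnc
  | r + 2, _, F => exact (hasTwoRowCDM_pi_zmod_two_pow r _).congr F.symm

theorem isCDM_zero_of_signedNondegenerate {G : Type*} [AddCommGroup G] [Finite G] {k l : ℕ}
    (M : Fin k → Fin l → G) (hcard : Nat.card G = 2 ^ l) (hM : SignedNondegenerate M) :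
    IsCDM 2 M 0 := by
  have hJ : Nat.card (Fin l → ZMod 2) = Nat.card G := by
    simp [hcard]
  have val_sub (u v : ZMod 2) : |((u.val : ℤ) - v.val)| ≤ 1 := by
    have := u.val_lt
    have := v.val_lt
    rw [abs_le]
    omega
  have sub_eq {κ : Type} (u v : κ → ZMod 2)
      (h : (fun i => ((u i).val : ℤ) - (v i).val) = 0) : u = v := by
    ext1 i
    have := congrFun h i
    apply ZMod.val_injective
    simp only [Pi.zero_apply] at this
    omega
  refine ⟨by simpa using hJ, fun r s hrs g => ?_⟩
  have inj : Function.Injective fun c => pExpand 2 M r c - pExpand 2 M s c := by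
    intro c d hcd
    have h0 : signedForm M (fun i => ((r i).val : ℤ) - (s i).val)
        (fun j => ((c j).val : ℤ) - (d j).val) = 0 := by
      rw [← sub_eq_zero.2 hcd]
      simp only [signedForm, pExpand, ← Finset.sum_sub_distrib]
      refine Finset.sum_congr rfl fun i _ => Finset.sum_congr rfl fun j _ => ?_
      simp only [← natCast_zsmul, ← sub_smul]
      congr 1
      push_cast
      ring
    obtain h | h := hM _ _ (fun i => val_sub _ _) (fun j => val_sub _ _) h0
    · exact absurd (sub_eq _ _ h) hrs
    · exact sub_eq _ _ h
  have bij := (Nat.bijective_iff_injective_and_card _).2 ⟨inj, hJ⟩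
  obtain ⟨c, hc⟩ := bij.2 g
  rw [pow_zero, Nat.card_eq_one_iff_unique]
  exact ⟨⟨fun x y => Subtype.ext (inj (x.2.trans y.2.symm))⟩, ⟨⟨c, hc⟩⟩⟩

/-- Every finite abelian noncyclic 2-group admits a `(G, 2, 0)` contracted difference
matrix. -/
theorem stmt_18 (G : Type*) [AddCommGroup G] [Finite G]
    (h2 : ∃ n : ℕ, Nat.card G = 2 ^ n) (hnc : ¬ IsAddCyclic G) :
    ∃ (l : ℕ) (M : Fin 2 → Fin l → G), IsCDM 2 M 0 := by
  obtain ⟨ι, _, M, hcard, hM⟩ := hasTwoRowCDM_of_not_isAddCyclic G h2 hnc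
  let σ := Fintype.equivFin ι
  refine ⟨_, fun i j => M i (σ.symm j), isCDM_zero_of_signedNondegenerate _ hcard ?_⟩
  intro a b ha hb h
  refine (hM a (b ∘ σ) ha (fun j => hb _) ?_).imp_right fun h' => ?_
  · rw [← h]
    refine Finset.sum_congr rfl fun i _ => ?_
    rw [← σ.sum_comp]
    simp
  · ext j
    simpa using congrFun h' (σ.symm j)
end
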